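/- Let 0<q<1 and let n > r > 0 be integers. Then G_0[n,r] = ζ[n], where G_0[n,r] denotes the sum of all multiple q-zeta values ζ[n_1,...,n_r] over multi-indices (n_1,...,n_r) of positive integers with n_1 ≥ 2 and n_1 + n_2 + ... + n_r = n. -/

import Mathlib

/-- The `q`-analog of a natural number: `[k]_q = (1-q^k)/(1-q)`. -/
noncomputable def qnum (q : ℝ) (k : ℕ) : ℝ := (1 - q ^ k) / (1 - q)

/-- The multiple `q`-zeta value `ζ[n₁,…,n_r]`, summed over all strictly
decreasing tuples of positive integers `k₁ > k₂ > ⋯ > k_r > 0`. -/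
noncomputable def qmzv (q : ℝ) {r : ℕ} (n : Fin r → ℕ) : ℝ :=
  ∑' k : {k : Fin r → ℕ // (∀ i j : Fin r, i < j → k j < k i) ∧ ∀ j, 0 < k j},
    ∏ j : Fin r, q ^ ((n j - 1) * k.1 j) / (qnum q (k.1 j)) ^ (n j)

open scoped ENNReal Topology

theorem qnum_succ (q : ℝ) (hq1 : q < 1) (k : ℕ) : qnum q (k + 1) = qnum q k + q ^ k := by
  have : 1 - q ≠ 0 := by linarith
  unfold qnum
  field_simp
  ring

theorem qnum_add (q : ℝ) (hq1 : q < 1) (k l : ℕ) :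
    qnum q (k + l) = qnum q k + q ^ k * qnum q l := by
  have : 1 - q ≠ 0 := by linarith
  unfold qnum
  field_simp
  ring

theorem one_le_qnum_succ {q : ℝ} (hq0 : 0 < q) (hq1 : q < 1) (k : ℕ) : 1 ≤ qnum q (k + 1) := by
  induction k with
  | zero => simp [qnum, div_self (by linarith : (1 : ℝ) - q ≠ 0)]
  | succ k ih =>
    rw [qnum_succ q hq1]
    have := pow_pos hq0 (k + 1)
    linarith

/-- The shifted `q`-number `[k]_q - x q^k`. -/
noncomputable def shiftedQnum (q x : ℝ) (k : ℕ) : ℝ := qnum q k - x * q ^ k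

/-- The product of the shifted `q`-numbers of index `1, …, n`. -/
noncomputable def shiftedFactorial (q x : ℝ) (n : ℕ) : ℝ :=
  ∏ i ∈ Finset.range n, shiftedQnum q x (i + 1)

/-- The Seki–Yamamoto connector. -/
noncomputable def connector (q x : ℝ) (n m : ℕ) : ℝ :=
  q ^ (n * m) * shiftedFactorial q x n * shiftedFactorial q x m / shiftedFactorial q x (n + m)

section Connector

variable {q x : ℝ}

theorem shiftedQnum_pos (hq0 : 0 < q) (hq1 : q < 1) (hx1 : x ≤ 1) (k : ℕ) :
    0 < shiftedQnum q x (k + 1) := by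
  have h1 := one_le_qnum_succ hq0 hq1 k
  have h2 : q ^ (k + 1) < 1 := pow_lt_one₀ hq0.le hq1 (by omega)
  have h3 := pow_pos hq0 (k + 1)
  unfold shiftedQnum
  nlinarith

theorem shiftedQnum_monotone (hq0 : 0 < q) (hq1 : q < 1) (hx0 : 0 ≤ x) :
    Monotone (shiftedQnum q x) := by
  refine monotone_nat_of_le_succ fun k => ?_
  have h3 := pow_pos hq0 k
  have h4 : q ^ (k + 1) ≤ q ^ k := pow_le_pow_of_le_one hq0.le hq1.le (by omega)
  unfold shiftedQnum
  rw [qnum_succ q hq1]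
  nlinarith

theorem shiftedFactorial_pos (hq0 : 0 < q) (hq1 : q < 1) (hx1 : x ≤ 1) (n : ℕ) :
    0 < shiftedFactorial q x n :=
  Finset.prod_pos fun i _ => shiftedQnum_pos hq0 hq1 hx1 i

theorem shiftedFactorial_succ (n : ℕ) :
    shiftedFactorial q x (n + 1) = shiftedFactorial q x n * shiftedQnum q x (n + 1) :=
  Finset.prod_range_succ _ _

theorem connector_comm (n m : ℕ) : connector q x n m = connector q x m n := by
  unfold connector
  rw [mul_comm n m, add_comm n m]
  ring

theorem connector_pos (hq0 : 0 < q) (hq1 : q < 1) (hx1 : x ≤ 1) (n m : ℕ) :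
    0 < connector q x n m := by
  have := shiftedFactorial_pos hq0 hq1 hx1
  exact div_pos (mul_pos (mul_pos (pow_pos hq0 _) (this n)) (this m)) (this _)

theorem connector_zero_left (hq0 : 0 < q) (hq1 : q < 1) (hx1 : x ≤ 1) (m : ℕ) :
    connector q x 0 m = 1 := by
  have := shiftedFactorial_pos hq0 hq1 hx1 m
  have h0 : shiftedFactorial q x 0 = 1 := by simp [shiftedFactorial]
  simp [connector, h0, this.ne']

theorem connector_succ_right (hq0 : 0 < q) (hq1 : q < 1) (hx1 : x ≤ 1) (n m : ℕ) :
    connector q x n (m + 1) * shiftedQnum q x (n + m + 1) =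
      connector q x n m * (q ^ n * shiftedQnum q x (m + 1)) := by
  have h1 := (shiftedFactorial_pos hq0 hq1 hx1 (n + m)).ne'
  have h2 := (shiftedQnum_pos hq0 hq1 hx1 (n + m)).ne'
  unfold connector
  rw [← add_assoc, shiftedFactorial_succ, shiftedFactorial_succ]
  field_simp
  ring

theorem connector_le (hq0 : 0 < q) (hq1 : q < 1) (hx0 : 0 ≤ x) (hx1 : x ≤ 1) (n m : ℕ) :
    connector q x n m ≤ (q ^ n) ^ m := by
  induction m with
  | zero => rw [connector_comm, connector_zero_left hq0 hq1 hx1, pow_zero]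
  | succ m ih =>
    have h := connector_succ_right hq0 hq1 hx1 n m
    have hc := shiftedQnum_pos hq0 hq1 hx1 (n + m)
    have hle : shiftedQnum q x (m + 1) ≤ shiftedQnum q x (n + m + 1) :=
      shiftedQnum_monotone hq0 hq1 hx0 (by omega)
    have hp := connector_pos hq0 hq1 hx1 n m
    have hq := pow_pos hq0 n
    refine le_of_mul_le_mul_right ?_ hc
    rw [h, pow_succ, mul_assoc]
    have := shiftedQnum_pos hq0 hq1 hx1 m
    gcongr

theorem connector_sub (hq0 : 0 < q) (hq1 : q < 1) (hx1 : x ≤ 1) (n m : ℕ) :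
    connector q x (n + 1) m - connector q x (n + 1) (m + 1) =
      connector q x (n + 1) (m + 1) / shiftedQnum q x (m + 1) *
        (qnum q (n + 1) / q ^ (n + 1)) := by
  have h := connector_succ_right hq0 hq1 hx1 (n + 1) m
  have hc := (shiftedQnum_pos hq0 hq1 hx1 m).ne'
  have hq := (pow_pos hq0 (n + 1)).ne'
  have hs : shiftedQnum q x (n + 1 + m + 1) =
      qnum q (n + 1) + q ^ (n + 1) * shiftedQnum q x (m + 1) := by
    unfold shiftedQnum
    rw [add_assoc, qnum_add q hq1, pow_add]
    ring
  rw [hs] at h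
  field_simp
  linear_combination -h

theorem hasSum_connector_div (hq0 : 0 < q) (hq1 : q < 1) (hx0 : 0 ≤ x) (hx1 : x ≤ 1)
    (n M : ℕ) :
    HasSum (fun d => connector q x (n + 1) (M + d + 1) / shiftedQnum q x (M + d + 1))
      (q ^ (n + 1) / qnum q (n + 1) * connector q x (n + 1) M) := by
  have hn : 0 < qnum q (n + 1) := zero_lt_one.trans_le (one_le_qnum_succ hq0 hq1 n)
  have hq := pow_pos hq0 (n + 1)
  have hterm : ∀ d, connector q x (n + 1) (M + d + 1) / shiftedQnum q x (M + d + 1) =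
      q ^ (n + 1) / qnum q (n + 1) *
        (connector q x (n + 1) (M + d) - connector q x (n + 1) (M + (d + 1))) := by
    intro d
    rw [← add_assoc, connector_sub hq0 hq1 hx1]
    field_simp
  have hlim : Filter.Tendsto (connector q x (n + 1)) Filter.atTop (𝓝 0) :=
    squeeze_zero (fun m => (connector_pos hq0 hq1 hx1 (n + 1) m).le)
      (connector_le hq0 hq1 hx0 hx1 (n + 1))
      (tendsto_pow_atTop_nhds_zero_of_lt_one hq.le (pow_lt_one₀ hq0.le hq1 (by omega)))
  rw [hasSum_iff_tendsto_nat_of_nonneg fun d => div_nonneg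
    (connector_pos hq0 hq1 hx1 _ _).le (shiftedQnum_pos hq0 hq1 hx1 _).le]
  simp_rw [hterm, ← Finset.mul_sum,
    Finset.sum_range_sub' fun d => connector q x (n + 1) (M + d)]
  have h2 : Filter.Tendsto (fun d => connector q x (n + 1) (M + d)) Filter.atTop (𝓝 0) := by
    simpa only [add_comm] using (Filter.tendsto_add_atTop_iff_nat M).2 hlim
  simpa using (tendsto_const_nhds.sub h2).const_mul (q ^ (n + 1) / qnum q (n + 1))

theorem tsum_connector_mul_inv (hq0 : 0 < q) (hq1 : q < 1) (hx0 : 0 ≤ x) (hx1 : x ≤ 1)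
    (n M : ℕ) :
    ∑' d, ENNReal.ofReal (connector q x (n + 1) (M + d + 1)) *
        ENNReal.ofReal (shiftedQnum q x (M + d + 1))⁻¹ =
      ENNReal.ofReal (q ^ (n + 1) / qnum q (n + 1)) *
        ENNReal.ofReal (connector q x (n + 1) M) := by
  have h := hasSum_connector_div hq0 hq1 hx0 hx1 n M
  have hp := fun m => (connector_pos hq0 hq1 hx1 (n + 1) m).le
  have hn : 0 < qnum q (n + 1) := zero_lt_one.trans_le (one_le_qnum_succ hq0 hq1 n)
  rw [← ENNReal.ofReal_mul (by positivity), ← h.tsum_eq, ENNReal.ofReal_tsum_of_nonneg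
    (fun d => div_nonneg (hp _) (shiftedQnum_pos hq0 hq1 hx1 _).le) h.summable]
  simp_rw [div_eq_mul_inv, ENNReal.ofReal_mul (hp _)]

end Connector

/-- Strictly decreasing `r`-tuples of natural numbers greater than `N`. -/
abbrev DecreasingAbove (r N : ℕ) : Type :=
  {k : Fin r → ℕ // (∀ i j : Fin r, i < j → k j < k i) ∧ ∀ j, N < k j}

/-- Appending a smallest entry to a decreasing tuple. -/
def DecreasingAbove.snoc {r N : ℕ} (p : Σ d : ℕ, DecreasingAbove r (N + d + 1)) :
    DecreasingAbove (r + 1) N :=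
  ⟨Fin.snoc (α := fun _ => ℕ) p.2.1 (N + p.1 + 1), by
    obtain ⟨d, k, hk, hN⟩ := p
    constructor
    · intro i j hij
      induction i using Fin.lastCases with
      | last => exact absurd hij (Fin.le_last j).not_gt
      | cast i =>
        induction j using Fin.lastCases with
        | last => simpa using hN i
        | cast j => simpa using hk i j (by simpa using hij)
    · intro j
      induction j using Fin.lastCases with
      | last => simp
      | cast j =>
        have := hN j
        simp only [Fin.snoc_castSucc]
        omega⟩

theorem DecreasingAbove.snoc_bijective (r N : ℕ) :
    Function.Bijective (DecreasingAbove.snoc (r := r) (N := N)) := by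
  constructor
  · rintro ⟨d, k, hk⟩ ⟨d', k', hk'⟩ h
    have h' := congrArg Subtype.val h
    simp only [DecreasingAbove.snoc] at h'
    obtain ⟨h1, h2⟩ := Fin.snoc_inj.1 h'
    obtain rfl : d = d' := by omega
    subst h1
    rfl
  · rintro ⟨k, hk, hN⟩
    have hl := hN (Fin.last r)
    have hd : N + (k (Fin.last r) - N - 1) + 1 = k (Fin.last r) := by omega
    refine ⟨⟨k (Fin.last r) - N - 1, fun i => k i.castSucc, fun i j hij =>
      hk _ _ (by simpa using hij), fun j => ?_⟩, ?_⟩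
    · rw [hd]
      exact hk _ _ (Fin.castSucc_lt_last j)
    · apply Subtype.ext
      simp only [DecreasingAbove.snoc, hd]
      exact Fin.snoc_init_self k

theorem tsum_decreasingAbove_succ {r N : ℕ} (F : (Fin (r + 1) → ℕ) → ℝ≥0∞) :
    ∑' k : DecreasingAbove (r + 1) N, F k.1 =
      ∑' d, ∑' k : DecreasingAbove r (N + d + 1),
        F (Fin.snoc (α := fun _ => ℕ) k.1 (N + d + 1)) := by
  rw [← ENNReal.tsum_sigma fun d (k : DecreasingAbove r (N + d + 1)) =>
    F (Fin.snoc (α := fun _ => ℕ) k.1 (N + d + 1))]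
  exact ((Equiv.ofBijective _ (DecreasingAbove.snoc_bijective r N)).tsum_eq
    fun k => F k.1).symm

instance (N : ℕ) : Unique (DecreasingAbove 0 N) where
  default := ⟨Fin.elim0, fun i => i.elim0, fun i => i.elim0⟩
  uniq _ := Subtype.ext (Subsingleton.elim _ _)

theorem tsum_decreasingAbove_one {N : ℕ} (F : (Fin 1 → ℕ) → ℝ≥0∞) :
    ∑' k : DecreasingAbove 1 N, F k.1 = ∑' d, F fun _ => N + d + 1 := by
  rw [tsum_decreasingAbove_succ]
  refine tsum_congr fun d => ?_
  rw [tsum_fintype, Fintype.sum_unique]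
  congr 1

theorem tsum_connector_mul_prod {q x : ℝ} (hq0 : 0 < q) (hq1 : q < 1) (hx0 : 0 ≤ x)
    (hx1 : x ≤ 1) (m r N : ℕ) :
    ∑' k : DecreasingAbove (r + 1) N, ENNReal.ofReal (connector q x (m + 1) (k.1 0)) *
        ∏ j, ENNReal.ofReal (shiftedQnum q x (k.1 j))⁻¹ =
      ENNReal.ofReal (q ^ (m + 1) / qnum q (m + 1)) ^ (r + 1) *
        ENNReal.ofReal (connector q x (m + 1) N) := by
  induction r generalizing N with
  | zero =>
    rw [tsum_decreasingAbove_one fun k => ENNReal.ofReal (connector q x (m + 1) (k 0)) *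
      ∏ j, ENNReal.ofReal (shiftedQnum q x (k j))⁻¹]
    simpa using tsum_connector_mul_inv hq0 hq1 hx0 hx1 m N
  | succ r ih =>
    rw [tsum_decreasingAbove_succ fun k => ENNReal.ofReal (connector q x (m + 1) (k 0)) *
      ∏ j, ENNReal.ofReal (shiftedQnum q x (k j))⁻¹]
    have h0 : ∀ (k : Fin (r + 1) → ℕ) (l : ℕ),
        (Fin.snoc (α := fun _ => ℕ) k l : Fin (r + 2) → ℕ) 0 = k 0 := fun k l =>
      Fin.snoc_castSucc (α := fun _ => ℕ) l k 0
    simp_rw [h0, Fin.prod_univ_castSucc (n := r + 1), Fin.snoc_castSucc, Fin.snoc_last, ← mul_assoc,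
      ENNReal.tsum_mul_right]
    simp_rw [ih, mul_assoc, ENNReal.tsum_mul_left,
      tsum_connector_mul_inv hq0 hq1 hx0 hx1 m N]
    ring

theorem ENNReal.tsum_fin_prod (r : ℕ) (g : Fin r → ℕ → ℝ≥0∞) :
    ∑' e : Fin r → ℕ, ∏ j, g j (e j) = ∏ j, ∑' i, g j i := by
  induction r with
  | zero => simp
  | succ r ih =>
    rw [← (Fin.consEquiv fun _ : Fin (r + 1) => ℕ).tsum_eq, ENNReal.tsum_prod']
    simp [Fin.prod_univ_succ, ENNReal.tsum_mul_left, ENNReal.tsum_mul_right, ih, Fin.consEquiv]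

theorem ENNReal.coeff_zero_le {A B : ℕ → ℝ≥0∞} (hB : ∑' i, B i ≠ ∞)
    (h : ∀ x : ℝ, 0 < x → x ≤ 1 →
      ∑' i, ENNReal.ofReal x ^ i * A i = ∑' i, ENNReal.ofReal x ^ i * B i) :
    A 0 ≤ B 0 := by
  have hle : ∀ x : ℝ, 0 < x → x ≤ 1 →
      A 0 ≤ B 0 + ENNReal.ofReal x * ∑' i, B i := by
    intro x hx hx1
    have hX : ENNReal.ofReal x ≤ 1 := by simpa using hx1
    calc A 0 = ENNReal.ofReal x ^ 0 * A 0 := by simp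
      _ ≤ ∑' i, ENNReal.ofReal x ^ i * A i :=
        ENNReal.le_tsum (f := fun i => ENNReal.ofReal x ^ i * A i) 0
      _ = ∑' i, ENNReal.ofReal x ^ i * B i := h x hx hx1
      _ = B 0 + ∑' i, ENNReal.ofReal x ^ (i + 1) * B (i + 1) := by
        rw [tsum_eq_zero_add' ENNReal.summable]; simp
      _ ≤ B 0 + ∑' i, ENNReal.ofReal x * B (i + 1) := by
        refine add_le_add_right (ENNReal.tsum_le_tsum fun i => ?_) _
        gcongr
        exact pow_le_of_le_one zero_le hX (by omega)
      _ ≤ B 0 + ENNReal.ofReal x * ∑' i, B i := by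
        rw [ENNReal.tsum_mul_left]
        refine add_le_add_right (mul_le_mul_right ?_ _) _
        exact ENNReal.tsum_comp_le_tsum_of_injective (add_left_injective 1) B
  have hlim : Filter.Tendsto (fun x : ℝ => B 0 + ENNReal.ofReal x * ∑' i, B i)
      (𝓝[>] 0) (𝓝 (B 0)) := by
    have h1 : Filter.Tendsto ENNReal.ofReal (𝓝[>] 0) (𝓝 0) := by
      simpa using (ENNReal.continuous_ofReal.tendsto 0).mono_left nhdsWithin_le_nhds
    simpa using tendsto_const_nhds.add (ENNReal.Tendsto.mul_const h1 (Or.inr hB))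
  refine ge_of_tendsto hlim ?_
  filter_upwards [Ioc_mem_nhdsGT (zero_lt_one (α := ℝ))] with x hx
  exact hle x hx.1 hx.2

theorem ENNReal.coeff_eq {A B : ℕ → ℝ≥0∞} (hB : ∑' i, B i ≠ ∞)
    (h : ∀ x : ℝ, 0 < x → x ≤ 1 →
      ∑' i, ENNReal.ofReal x ^ i * A i = ∑' i, ENNReal.ofReal x ^ i * B i) (n : ℕ) :
    A n = B n := by
  have hA : ∑' i, A i ≠ ∞ := by
    have := h 1 one_pos le_rfl
    simp only [ENNReal.ofReal_one, one_pow, one_mul] at this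
    rwa [this]
  induction n generalizing A B with
  | zero =>
    exact le_antisymm (coeff_zero_le hB h)
      (coeff_zero_le hA fun x hx hx1 => (h x hx hx1).symm)
  | succ n ih =>
    have h0 : A 0 = B 0 := le_antisymm (coeff_zero_le hB h)
      (coeff_zero_le hA fun x hx hx1 => (h x hx hx1).symm)
    have hshift : ∀ {D : ℕ → ℝ≥0∞}, ∑' i, D i ≠ ∞ → ∑' i, D (i + 1) ≠ ∞ := fun hD =>
      ne_top_of_le_ne_top hD
        (ENNReal.tsum_comp_le_tsum_of_injective (add_left_injective 1) _)
    refine ih (A := fun i => A (i + 1)) (B := fun i => B (i + 1)) (hshift hB) ?_ (hshift hA)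
    intro x hx hx1
    have hx' := h x hx hx1
    rw [tsum_eq_zero_add' ENNReal.summable,
      tsum_eq_zero_add' (f := fun i => ENNReal.ofReal x ^ i * B i) ENNReal.summable, h0] at hx'
    simp only [pow_zero, one_mul] at hx'
    have hB0 : B 0 ≠ ∞ := ENNReal.ne_top_of_tsum_ne_top hB 0
    have := (ENNReal.add_right_inj hB0).1 hx'
    simp_rw [pow_succ', mul_assoc, ENNReal.tsum_mul_left] at this
    exact (ENNReal.mul_right_inj (by simpa using hx) ENNReal.ofReal_ne_top).1 this

/-- The `ℝ≥0∞`-valued multiple `q`-zeta value with exponents `e₀ + 2, e₁ + 1, …, e_r + 1`. -/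
noncomputable def qmzvENNReal (q : ℝ) {r : ℕ} (e : Fin (r + 1) → ℕ) : ℝ≥0∞ :=
  ∑' k : DecreasingAbove (r + 1) 0, ENNReal.ofReal (q ^ k.1 0 / qnum q (k.1 0)) *
    ∏ j, ENNReal.ofReal (qnum q (k.1 j))⁻¹ * ENNReal.ofReal (q ^ k.1 j / qnum q (k.1 j)) ^ e j

theorem qnum_pos {q : ℝ} (hq0 : 0 < q) (hq1 : q < 1) {k : ℕ} (hk : 0 < k) : 0 < qnum q k := by
  obtain ⟨k, rfl⟩ := Nat.exists_eq_succ_of_ne_zero hk.ne'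
  exact zero_lt_one.trans_le (one_le_qnum_succ hq0 hq1 k)

theorem qmzv_eq_toReal {q : ℝ} (hq0 : 0 < q) (hq1 : q < 1) {r : ℕ} (e : Fin (r + 1) → ℕ) :
    qmzv q (e + 1 + Pi.single 0 1) = (qmzvENNReal q e).toReal := by
  unfold qmzv qmzvENNReal
  rw [ENNReal.tsum_toReal_eq fun k => ENNReal.mul_ne_top ENNReal.ofReal_ne_top
    (ENNReal.prod_ne_top fun j _ => by finiteness)]
  refine tsum_congr fun k => ?_
  have hb : ∀ j, 0 < qnum q (k.1 j) := fun j => qnum_pos hq0 hq1 (k.2.2 j)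
  have ha : ∀ j, 0 ≤ q ^ k.1 j / qnum q (k.1 j) := fun j =>
    div_nonneg (pow_pos hq0 _).le (hb j).le
  simp only [ENNReal.toReal_mul, ENNReal.toReal_prod, ENNReal.toReal_pow,
    ENNReal.toReal_ofReal (ha _), ENNReal.toReal_ofReal (inv_nonneg.2 (hb _).le)]
  rw [Fin.prod_univ_succ, Fin.prod_univ_succ, ← mul_assoc]
  congr 1
  · have := (hb 0).ne'
    simp only [Pi.add_apply, Pi.one_apply, Pi.single_eq_same, Nat.add_sub_cancel, div_pow, ← pow_mul]
    field_simp
    ring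
  · refine Finset.prod_congr rfl fun j _ => ?_
    have := (hb j.succ).ne'
    simp only [Pi.add_apply, Pi.one_apply, Pi.single_eq_of_ne (Fin.succ_ne_zero j), add_zero,
      Nat.add_sub_cancel, div_pow, ← pow_mul]
    field_simp
    ring

theorem qmzvENNReal_depth_one (q : ℝ) (n : ℕ) :
    qmzvENNReal q (fun _ : Fin 1 => n) =
      ∑' d, ENNReal.ofReal (qnum q (d + 1))⁻¹ *
        ENNReal.ofReal (q ^ (d + 1) / qnum q (d + 1)) ^ (n + 1) := by
  unfold qmzvENNReal
  rw [tsum_decreasingAbove_one fun k : Fin 1 → ℕ => ENNReal.ofReal (q ^ k 0 / qnum q (k 0)) *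
    ∏ j, ENNReal.ofReal (qnum q (k j))⁻¹ * ENNReal.ofReal (q ^ k j / qnum q (k j)) ^ n]
  refine tsum_congr fun d => ?_
  simp only [Fin.prod_univ_one, zero_add]
  ring

theorem tsum_pow_mul_pow {q x : ℝ} (hq0 : 0 < q) (hq1 : q < 1) (hx0 : 0 ≤ x) (hx1 : x ≤ 1)
    {k : ℕ} (hk : 0 < k) :
    ∑' i, ENNReal.ofReal x ^ i * (ENNReal.ofReal (qnum q k)⁻¹ *
        ENNReal.ofReal (q ^ k / qnum q k) ^ i) =
      ENNReal.ofReal (shiftedQnum q x k)⁻¹ := by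
  have hb := qnum_pos hq0 hq1 hk
  have hc : 0 < shiftedQnum q x k := by
    obtain ⟨k, rfl⟩ := Nat.exists_eq_succ_of_ne_zero hk.ne'
    exact shiftedQnum_pos hq0 hq1 hx1 k
  have hr : 1 - x * (q ^ k / qnum q k) = shiftedQnum q x k / qnum q k := by
    unfold shiftedQnum
    field_simp
  have hpos : 0 < 1 - x * (q ^ k / qnum q k) := hr ▸ div_pos hc hb
  have hy : 0 ≤ x * (q ^ k / qnum q k) := by positivity
  simp_rw [mul_left_comm _ (ENNReal.ofReal (qnum q k)⁻¹), ← mul_pow, ENNReal.tsum_mul_left,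
    ENNReal.tsum_geometric, ← ENNReal.ofReal_mul hx0]
  rw [← ENNReal.ofReal_one, ← ENNReal.ofReal_sub _ hy, ← ENNReal.ofReal_inv_of_pos hpos,
    ← ENNReal.ofReal_mul (by positivity), hr]
  congr 1
  field_simp

theorem tsum_decreasingAbove_shiftedQnum {q x : ℝ} (hq0 : 0 < q) (hq1 : q < 1) (hx0 : 0 ≤ x)
    (hx1 : x ≤ 1) (r : ℕ) :
    ∑' k : DecreasingAbove (r + 1) 0, ENNReal.ofReal (q ^ k.1 0 / qnum q (k.1 0)) *
        ∏ j, ENNReal.ofReal (shiftedQnum q x (k.1 j))⁻¹ =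
      ∑' m, ENNReal.ofReal (shiftedQnum q x (m + 1))⁻¹ *
        ENNReal.ofReal (q ^ (m + 1) / qnum q (m + 1)) ^ (r + 1) := by
  have h : ∀ k : ℕ, 0 < k → ENNReal.ofReal (q ^ k / qnum q k) =
      ∑' m, ENNReal.ofReal (shiftedQnum q x (m + 1))⁻¹ *
        ENNReal.ofReal (connector q x (m + 1) k) := by
    intro k hk
    obtain ⟨k, rfl⟩ := Nat.exists_eq_succ_of_ne_zero hk.ne'
    have := tsum_connector_mul_inv hq0 hq1 hx0 hx1 k 0
    rw [connector_comm (k + 1) 0, connector_zero_left hq0 hq1 hx1, ENNReal.ofReal_one,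
      mul_one] at this
    rw [Nat.succ_eq_add_one, ← this]
    refine tsum_congr fun m => ?_
    rw [connector_comm, mul_comm, zero_add]
  have h' : ∀ k : DecreasingAbove (r + 1) 0, ENNReal.ofReal (q ^ k.1 0 / qnum q (k.1 0)) =
      ∑' m, ENNReal.ofReal (shiftedQnum q x (m + 1))⁻¹ *
        ENNReal.ofReal (connector q x (m + 1) (k.1 0)) := fun k => h _ (k.2.2 0)
  simp_rw [h', ← ENNReal.tsum_mul_right]
  rw [ENNReal.tsum_comm]
  simp_rw [mul_assoc, ENNReal.tsum_mul_left, tsum_connector_mul_prod hq0 hq1 hx0 hx1,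
    connector_comm _ 0, connector_zero_left hq0 hq1 hx1, ENNReal.ofReal_one, mul_one]

theorem tsum_pow_mul_tsum_qmzvENNReal {q x : ℝ} (hq0 : 0 < q) (hq1 : q < 1) (hx0 : 0 ≤ x)
    (hx1 : x ≤ 1) (r : ℕ) :
    ∑' h, ENNReal.ofReal x ^ h * ∑' e : {e : Fin (r + 1) → ℕ // ∑ j, e j = h},
        qmzvENNReal q e.1 =
      ∑' k : DecreasingAbove (r + 1) 0, ENNReal.ofReal (q ^ k.1 0 / qnum q (k.1 0)) *
        ∏ j, ENNReal.ofReal (shiftedQnum q x (k.1 j))⁻¹ := by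
  calc _ = ∑' h, ∑' e : {e : Fin (r + 1) → ℕ // ∑ j, e j = h},
        ENNReal.ofReal x ^ (∑ j, e.1 j) * qmzvENNReal q e.1 := by
        refine tsum_congr fun h => ?_
        rw [← ENNReal.tsum_mul_left]
        exact tsum_congr fun e => by rw [e.2]
    _ = ∑' e : Fin (r + 1) → ℕ, ENNReal.ofReal x ^ (∑ j, e j) * qmzvENNReal q e := by
        rw [← (Equiv.sigmaFiberEquiv fun e : Fin (r + 1) → ℕ => ∑ j, e j).tsum_eq,
          ENNReal.tsum_sigma']
        rfl
    _ = ∑' k : DecreasingAbove (r + 1) 0, ENNReal.ofReal (q ^ k.1 0 / qnum q (k.1 0)) *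
          ∑' e : Fin (r + 1) → ℕ, ∏ j, ENNReal.ofReal x ^ e j *
            (ENNReal.ofReal (qnum q (k.1 j))⁻¹ *
              ENNReal.ofReal (q ^ k.1 j / qnum q (k.1 j)) ^ e j) := by
        simp_rw [qmzvENNReal, ← ENNReal.tsum_mul_left]
        rw [ENNReal.tsum_comm]
        refine tsum_congr fun k => tsum_congr fun e => ?_
        rw [Finset.prod_mul_distrib (f := fun j => ENNReal.ofReal x ^ e j),
          Finset.prod_pow_eq_pow_sum, mul_left_comm]
    _ = _ := by
        refine tsum_congr fun k => ?_
        rw [ENNReal.tsum_fin_prod r.succ fun j i => ENNReal.ofReal x ^ i *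
            (ENNReal.ofReal (qnum q (k.1 j))⁻¹ *
              ENNReal.ofReal (q ^ k.1 j / qnum q (k.1 j)) ^ i)]
        simp_rw [tsum_pow_mul_pow hq0 hq1 hx0 hx1 (k.2.2 _)]

theorem tsum_pow_mul_qmzvENNReal_depth_one {q x : ℝ} (hq0 : 0 < q) (hq1 : q < 1) (hx0 : 0 ≤ x)
    (hx1 : x ≤ 1) (r : ℕ) :
    ∑' h, ENNReal.ofReal x ^ h * qmzvENNReal q (fun _ : Fin 1 => r + h) =
      ∑' m, ENNReal.ofReal (shiftedQnum q x (m + 1))⁻¹ *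
        ENNReal.ofReal (q ^ (m + 1) / qnum q (m + 1)) ^ (r + 1) := by
  simp_rw [qmzvENNReal_depth_one, ← ENNReal.tsum_mul_left]
  rw [ENNReal.tsum_comm]
  refine tsum_congr fun m => ?_
  rw [← tsum_pow_mul_pow hq0 hq1 hx0 hx1 m.succ_pos, ← ENNReal.tsum_mul_right]
  refine tsum_congr fun h => ?_
  rw [Nat.succ_eq_add_one]
  ring

theorem tsum_qmzvENNReal_depth_one_ne_top {q : ℝ} (hq0 : 0 < q) (hq1 : q < 1) (r : ℕ) :
    ∑' h, qmzvENNReal q (fun _ : Fin 1 => r + h) ≠ ∞ := by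
  have h := tsum_pow_mul_qmzvENNReal_depth_one hq0 hq1 zero_le_one le_rfl r
  simp only [ENNReal.ofReal_one, one_pow, one_mul] at h
  rw [h]
  have hq : ENNReal.ofReal q < 1 := by simpa using hq1
  refine ne_top_of_le_ne_top (b := ENNReal.ofReal (shiftedQnum q 1 1)⁻¹ *
    (1 - ENNReal.ofReal q)⁻¹) (ENNReal.mul_ne_top ENNReal.ofReal_ne_top
      (ENNReal.inv_ne_top.2 (tsub_pos_of_lt hq).ne')) ?_
  rw [← ENNReal.tsum_geometric, ← ENNReal.tsum_mul_left]
  refine ENNReal.tsum_le_tsum fun m => ?_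
  have h1 : shiftedQnum q 1 1 ≤ shiftedQnum q 1 (m + 1) :=
    shiftedQnum_monotone hq0 hq1 zero_le_one (by omega)
  have h0 : 0 < shiftedQnum q 1 1 := shiftedQnum_pos hq0 hq1 le_rfl 0
  have hle : q ^ (m + 1) / qnum q (m + 1) ≤ q ^ m :=
    (div_le_self (pow_pos hq0 _).le (one_le_qnum_succ hq0 hq1 m)).trans
      (pow_le_pow_of_le_one hq0.le hq1.le m.le_succ)
  have hle' : ENNReal.ofReal (q ^ (m + 1) / qnum q (m + 1)) ≤ ENNReal.ofReal q ^ m := by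
    rw [← ENNReal.ofReal_pow hq0.le]
    exact ENNReal.ofReal_le_ofReal hle
  refine mul_le_mul' (by gcongr) ?_
  exact (pow_le_of_le_one zero_le (hle'.trans (pow_le_one₀ zero_le hq.le))
    r.succ_ne_zero).trans hle'

theorem tsum_qmzvENNReal_eq {q : ℝ} (hq0 : 0 < q) (hq1 : q < 1) (r h : ℕ) :
    ∑' e : {e : Fin (r + 1) → ℕ // ∑ j, e j = h}, qmzvENNReal q e.1 =
      qmzvENNReal q (fun _ : Fin 1 => r + h) :=
  ENNReal.coeff_eq (A := fun h => ∑' e : {e : Fin (r + 1) → ℕ // ∑ j, e j = h},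
      qmzvENNReal q e.1) (B := fun h => qmzvENNReal q (fun _ : Fin 1 => r + h))
    (tsum_qmzvENNReal_depth_one_ne_top hq0 hq1 r)
    (fun x hx hx1 => by
      rw [tsum_pow_mul_tsum_qmzvENNReal hq0 hq1 hx.le hx1,
        tsum_decreasingAbove_shiftedQnum hq0 hq1 hx.le hx1,
        tsum_pow_mul_qmzvENNReal_depth_one hq0 hq1 hx.le hx1]) h

theorem sum_add_one_add_single {r : ℕ} (e : Fin (r + 1) → ℕ) :
    ∑ j, (e + 1 + Pi.single 0 1 : Fin (r + 1) → ℕ) j = ∑ j, e j + (r + 2) := by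
  simp [Finset.sum_add_distrib]
  ring

/-- Subtracting `2` from the first entry of an admissible index and `1` from the others. -/
def admissibleEquiv (r h : ℕ) :
    {e : Fin (r + 1) → ℕ // ∑ j, e j = h} ≃
      {v : Fin (r + 1) → ℕ // (∀ j, 1 ≤ v j) ∧ 2 ≤ v 0 ∧ ∑ j, v j = h + (r + 2)} where
  toFun e := ⟨e.1 + 1 + Pi.single 0 1, fun j => by simp; omega, by simp, by
    rw [sum_add_one_add_single, e.2]⟩
  invFun v := ⟨v.1 - 1 - Pi.single 0 1, by
    obtain ⟨v, hv1, hv2, hv⟩ := v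
    have hle : v - 1 - Pi.single 0 1 + 1 + Pi.single 0 1 = v := by
      ext j
      have := hv1 j
      rcases eq_or_ne j 0 with rfl | hj
      · simp; omega
      · simp [hj]; omega
    have := sum_add_one_add_single (v - 1 - Pi.single 0 1)
    rw [hle] at this
    exact Nat.add_right_cancel (this.symm.trans hv)⟩
  left_inv e := by
    ext j
    simp only [Pi.sub_apply, Pi.add_apply, Pi.one_apply]
    omega
  right_inv v := by
    obtain ⟨v, hv1, hv2, hv⟩ := v
    ext j
    have := hv1 j
    rcases eq_or_ne j 0 with rfl | hj
    · simp; omega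
    · simp [hj]; omega

/-- The sum `G₀[n,r]` of all multiple q-zeta values of weight `n` and depth `r`
equals `ζ[n]`. -/
theorem q_weight_depth_sum (q : ℝ) (hq0 : 0 < q) (hq1 : q < 1)
    (n r : ℕ) (hr : 0 < r) (hn : r < n) :
    (∑' v : {v : Fin r → ℕ // (∀ j, 1 ≤ v j) ∧ 2 ≤ v ⟨0, hr⟩ ∧ (∑ j, v j) = n},
        qmzv q v.1)
      = qmzv q (fun _ : Fin 1 => n) := by
  obtain ⟨r, rfl⟩ := Nat.exists_eq_succ_of_ne_zero hr.ne'
  obtain ⟨h, rfl⟩ : ∃ h, n = h + (r + 2) := ⟨n - (r + 2), by omega⟩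
  have hsum := tsum_qmzvENNReal_eq hq0 hq1 r h
  have hfin : ∑' e : {e : Fin (r + 1) → ℕ // ∑ j, e j = h}, qmzvENNReal q e.1 ≠ ∞ := by
    rw [hsum]
    exact ENNReal.ne_top_of_tsum_ne_top (tsum_qmzvENNReal_depth_one_ne_top hq0 hq1 r) h
  have hone : (fun _ : Fin 1 => h + (r + 2)) = (fun _ => r + h) + 1 + Pi.single 0 1 := by
    ext j
    rw [Fin.fin_one_eq_zero j]
    simp
    omega
  rw [hone, qmzv_eq_toReal hq0 hq1, ← hsum,
    ENNReal.tsum_toReal_eq (ENNReal.ne_top_of_tsum_ne_top hfin)]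
  refine ((admissibleEquiv r h).tsum_eq fun v => qmzv q v.1).symm.trans ?_
  exact tsum_congr fun e => qmzv_eq_toReal hq0 hq1 e.1
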